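/- Let S be a symmetric real 3×3 matrix and P a symmetric positive definite real 3×3 matrix with (unique symmetric positive definite) square root U (U² = P). Then tr[(S P⁻¹)²] = ‖U⁻¹ S U⁻¹‖² ≥ 0, and tr[(S P⁻¹)²] = ‖S P⁻¹‖² holds if and only if S P⁻¹ is symmetric. -/

import Mathlib

open Matrix

noncomputable section

/-- 3×3 real matrices. -/
abbrev M3 := Matrix (Fin 3) (Fin 3) ℝ

/-- Squared Frobenius norm: ‖X‖² = tr(X Xᵀ). -/
def frobNormSq (X : M3) : ℝ := (X * Xᵀ).trace

lemma frobNormSq_eq_sum (X : M3) : frobNormSq X = ∑ i, ∑ j, X i j ^ 2 := by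
  simp [frobNormSq, Matrix.trace, Matrix.mul_apply, sq]

lemma frobNormSq_nonneg (X : M3) : 0 ≤ frobNormSq X := by
  rw [frobNormSq_eq_sum]
  positivity

lemma frobNormSq_eq_zero_iff (X : M3) : frobNormSq X = 0 ↔ X = 0 := by
  simpa [frobNormSq] using Matrix.trace_mul_conjTranspose_self_eq_zero_iff (A := X)

lemma frobNormSq_transpose_sub (X : M3) :
    frobNormSq (Xᵀ - X) = 2 * (frobNormSq X - (X * X).trace) := by
  have h : (Xᵀ * Xᵀ).trace = (X * X).trace := by
    rw [← transpose_mul, trace_transpose]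
  simp only [frobNormSq, transpose_sub, transpose_transpose, sub_mul, mul_sub, trace_sub,
    h, trace_mul_comm Xᵀ X]
  ring

/-- Let `S` be symmetric and `P` symmetric positive definite with square root `U`
(`U² = P`, `U` symmetric positive definite). Then tr[(S P⁻¹)²] = ‖U⁻¹ S U⁻¹‖² ≥ 0, and
tr[(S P⁻¹)²] = ‖S P⁻¹‖² holds if and only if `S P⁻¹` is symmetric. -/
theorem stmt12 (S P U : M3) (hS : S = Sᵀ) (hP : P.PosDef) (hU : U.PosDef)
    (hUP : U * U = P) :
    ((S * P⁻¹) * (S * P⁻¹)).trace = frobNormSq (U⁻¹ * S * U⁻¹) ∧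
    0 ≤ ((S * P⁻¹) * (S * P⁻¹)).trace ∧
    (((S * P⁻¹) * (S * P⁻¹)).trace = frobNormSq (S * P⁻¹) ↔ (S * P⁻¹)ᵀ = S * P⁻¹) := by
  have hUt : U⁻¹ᵀ = U⁻¹ := by
    simpa using hU.isHermitian.inv.eq
  have key : ((S * P⁻¹) * (S * P⁻¹)).trace = frobNormSq (U⁻¹ * S * U⁻¹) := by
    rw [frobNormSq, transpose_mul, transpose_mul, hUt, ← hS, ← hUP, Matrix.mul_inv_rev,
      Matrix.mul_assoc U⁻¹ S, Matrix.mul_assoc U⁻¹, trace_mul_comm U⁻¹]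
    simp only [Matrix.mul_assoc]
  refine ⟨key, key ▸ frobNormSq_nonneg _, ?_⟩
  rw [← sub_eq_zero (a := (S * P⁻¹)ᵀ), ← frobNormSq_eq_zero_iff, frobNormSq_transpose_sub]
  constructor <;> intro h <;> linarith
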